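/- arXiv:1902.00874 — 2 statements merged into one kernel-verified Lean document; each statement's English description precedes it below -/
import Mathlib

section
/- Let φ : (0, 1/2] → [0, +∞) be an unbounded continuous decreasing function such that θ ↦ θ²·φ(θ) is nondecreasing; let φ̃ be the even 1-periodic extension of φ to ℝ and φ̃_A = min(φ̃, A). For every c₀ > 0 there exists C > 0 such that: for every A ≥ φ(1/2) and every δ ∈ (0, 1) with δ ≤ c₀·φ^{-1}(A), one has (φ̃_A * p_δ)(τ) ≤ C·(φ̃(τ) + 1) for every τ ∈ ℝ, where φ^{-1} is the inverse of φ. -/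
open MeasureTheory Set Filter
open scoped ENNReal

noncomputable section

/-- The Poisson kernel at radius `1-δ`: `p_δ(θ) = P_{1-δ}(e^{2πiθ})`. -/
def poissonKer (δ θ : ℝ) : ℝ :=
  (1 - (1 - δ) ^ 2) / (1 - 2 * (1 - δ) * Real.cos (2 * Real.pi * θ) + (1 - δ) ^ 2)

/-- Convolution of (1-periodic) functions on ℝ: `(f * g)(τ) = ∫_{-1/2}^{1/2} f(τ-θ)g(θ) dθ`,
for `f` with values in `[0,∞]` and a real kernel `g`. -/
def convPer (f : ℝ → ℝ≥0∞) (g : ℝ → ℝ) (τ : ℝ) : ℝ≥0∞ :=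
  ∫⁻ θ in Set.Ioc (-(1/2) : ℝ) (1/2), f (τ - θ) * ENNReal.ofReal (g θ)
theorem poissonKer_le {δ θ : ℝ} (hδ : δ ∈ Set.Ioo (0 : ℝ) 1) (hθ : |θ| ≤ 1 / 2) :
    poissonKer δ θ ≤ 4 * δ / (θ ^ 2 + δ ^ 2) := by
  obtain ⟨h0, h1⟩ := hδ
  have hcos : Real.cos (2 * Real.pi * θ) ≤ 1 - 8 * θ ^ 2 := by
    have h := Real.cos_le_one_sub_mul_cos_sq (x := 2 * Real.pi * θ) (by
      rw [abs_mul, abs_of_pos Real.two_pi_pos]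
      nlinarith [Real.pi_pos])
    have : 2 / Real.pi ^ 2 * (2 * Real.pi * θ) ^ 2 = 8 * θ ^ 2 := by
      field_simp
      ring
    linarith
  have hθ2 : θ ^ 2 ≤ 1 / 4 := by
    rw [← sq_abs]
    nlinarith [abs_nonneg θ]
  have hden : δ ^ 2 + 16 * (1 - δ) * θ ^ 2 ≤
      1 - 2 * (1 - δ) * Real.cos (2 * Real.pi * θ) + (1 - δ) ^ 2 := by
    nlinarith [mul_le_mul_of_nonneg_left hcos (sub_nonneg.2 h1.le)]
  have hpos : 0 < δ ^ 2 + 16 * (1 - δ) * θ ^ 2 := by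
    have := sub_pos.2 h1
    positivity
  have hcmp : (2 - δ) * (θ ^ 2 + δ ^ 2) ≤ 4 * (δ ^ 2 + 16 * (1 - δ) * θ ^ 2) := by
    rcases le_total δ (1 / 2) with h | h
    · nlinarith [sq_nonneg θ, sq_nonneg δ, mul_nonneg (sub_nonneg.2 h) (sq_nonneg θ),
        mul_nonneg h0.le (sq_nonneg δ)]
    · nlinarith [sq_nonneg θ, mul_nonneg (sub_nonneg.2 h1.le) (sq_nonneg θ),
        mul_nonneg h0.le (sq_nonneg δ)]
  unfold poissonKer
  rw [div_le_div_iff₀ (hpos.trans_le hden) (by positivity)]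
  calc (1 - (1 - δ) ^ 2) * (θ ^ 2 + δ ^ 2) = δ * ((2 - δ) * (θ ^ 2 + δ ^ 2)) := by ring
    _ ≤ δ * (4 * (δ ^ 2 + 16 * (1 - δ) * θ ^ 2)) := by gcongr
    _ = 4 * δ * (δ ^ 2 + 16 * (1 - δ) * θ ^ 2) := by ring
    _ ≤ _ := by gcongr

theorem lintegral_inv_sq_add_sq {s : ℝ} (hs : 0 < s) (a : ℝ) :
    ∫⁻ θ : ℝ, ENNReal.ofReal (((a - θ) ^ 2 + s ^ 2)⁻¹) = ENNReal.ofReal (Real.pi / s) := by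
  rw [lintegral_sub_left_eq_self (fun x : ℝ => ENNReal.ofReal ((x ^ 2 + s ^ 2)⁻¹)) a]
  have hfun : (fun x : ℝ => (x ^ 2 + s ^ 2)⁻¹) =
      fun x => (s ^ 2)⁻¹ * (1 + (x / s) ^ 2)⁻¹ := by
    ext x
    rw [← mul_inv]
    congr 1
    field_simp
    ring
  rw [← ofReal_integral_eq_lintegral_ofReal, hfun, integral_const_mul,
    Measure.integral_comp_div (fun y : ℝ => (1 + y ^ 2)⁻¹), integral_univ_inv_one_add_sq,
    abs_of_pos hs, smul_eq_mul]
  · congr 1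
    field_simp
  · rw [hfun]
    exact (integrable_inv_one_add_sq.comp_div hs.ne').const_mul _
  · exact Filter.Eventually.of_forall fun x => by positivity

theorem setLIntegral_poissonKer_le {δ : ℝ} (hδ : δ ∈ Set.Ioo (0 : ℝ) 1) :
    ∫⁻ θ in Set.Ioc (-(1/2) : ℝ) (1/2), ENNReal.ofReal (poissonKer δ θ)
      ≤ ENNReal.ofReal (4 * Real.pi) := by
  have h0 : 0 < δ := hδ.1
  calc ∫⁻ θ in Set.Ioc (-(1/2) : ℝ) (1/2), ENNReal.ofReal (poissonKer δ θ)
      ≤ ∫⁻ θ in Set.Ioc (-(1/2) : ℝ) (1/2),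
          ENNReal.ofReal (4 * δ) * ENNReal.ofReal (((0 - θ) ^ 2 + δ ^ 2)⁻¹) := by
        refine setLIntegral_mono' measurableSet_Ioc fun θ hθ => ?_
        rw [← ENNReal.ofReal_mul (by positivity)]
        refine ENNReal.ofReal_le_ofReal ?_
        rw [zero_sub, neg_sq, ← div_eq_mul_inv]
        exact poissonKer_le hδ (abs_le.2 ⟨hθ.1.le, hθ.2⟩)
    _ ≤ ∫⁻ θ : ℝ, ENNReal.ofReal (4 * δ) * ENNReal.ofReal (((0 - θ) ^ 2 + δ ^ 2)⁻¹) :=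
        setLIntegral_le_lintegral _ _
    _ = ENNReal.ofReal (4 * Real.pi) := by
        rw [lintegral_const_mul _ (by fun_prop), lintegral_inv_sq_add_sq h0,
          ← ENNReal.ofReal_mul (by positivity)]
        congr 1
        field_simp

theorem convPer_sub_int {f : ℝ → ℝ≥0∞} (hf : Function.Periodic f 1) (g : ℝ → ℝ) (τ : ℝ)
    (n : ℤ) : convPer f g (τ - n) = convPer f g τ := by
  unfold convPer
  congr 1
  ext θ
  rw [sub_right_comm]
  congr 1
  simpa using hf.sub_int_mul_eq n (x := τ - θ)

theorem convPer_le_of_le_const {f : ℝ → ℝ≥0∞} {a : ℝ≥0∞} (hf : ∀ θ, f θ ≤ a) {δ : ℝ}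
    (hδ : δ ∈ Set.Ioo (0 : ℝ) 1) (τ : ℝ) :
    convPer f (poissonKer δ) τ ≤ a * ENNReal.ofReal (4 * Real.pi) := by
  have hmeas : Measurable fun θ => ENNReal.ofReal (poissonKer δ θ) := by
    unfold poissonKer
    fun_prop
  calc convPer f (poissonKer δ) τ
      ≤ ∫⁻ θ in Set.Ioc (-(1/2) : ℝ) (1/2), a * ENNReal.ofReal (poissonKer δ θ) :=
        lintegral_mono fun θ => mul_le_mul_left (hf _) _
    _ ≤ _ := by
        rw [lintegral_const_mul _ hmeas]
        gcongr
        exact setLIntegral_poissonKer_le hδ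

/-- A periodic function which is at most `4 * B` at circle distance at least `|τ| / 2` from `0`
and at most `2 * τ ^ 2 * B / (v ^ 2 + s ^ 2)` closer to `0` has Poisson integral of order `B`
at `τ`, provided `δ` is at most of order `s`. -/
theorem convPer_poissonKer_le {f : ℝ → ℝ≥0∞} (hf : Function.Periodic f 1)
    {δ s τ B c : ℝ} (hδ : δ ∈ Set.Ioo (0 : ℝ) 1) (hs : 0 < s) (hτ : |τ| ≤ 1 / 2) (hτ0 : τ ≠ 0)
    (hB : 0 ≤ B) (hδs : δ ≤ c * s)
    (hfar : ∀ v, |v| ≤ 1 / 2 → |τ| / 2 ≤ |v| → f v ≤ ENNReal.ofReal (4 * B))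
    (hnear : ∀ v, |v| < |τ| / 2 → f v ≤ ENNReal.ofReal (2 * τ ^ 2 * B * (v ^ 2 + s ^ 2)⁻¹)) :
    convPer f (poissonKer δ) τ ≤ ENNReal.ofReal ((16 * Real.pi + 96 * Real.pi * c) * B) := by
  have h0 : 0 < δ := hδ.1
  have hτpos : 0 < |τ| := abs_pos.2 hτ0
  have hmeas : Measurable fun θ => ENNReal.ofReal (poissonKer δ θ) := by
    unfold poissonKer
    fun_prop
  set K : ℤ → ℝ → ℝ≥0∞ := fun k θ => ENNReal.ofReal (((τ - k - θ) ^ 2 + s ^ 2)⁻¹) with hK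
  have hKmeas : ∀ k, Measurable (K k) := fun k => by
    simp only [hK]
    fun_prop
  have hpt : ∀ θ ∈ Set.Ioc (-(1/2) : ℝ) (1/2),
      f (τ - θ) * ENNReal.ofReal (poissonKer δ θ) ≤
        ENNReal.ofReal (4 * B) * ENNReal.ofReal (poissonKer δ θ) +
          ENNReal.ofReal (32 * B * δ) * ∑ k ∈ ({-1, 0, 1} : Finset ℤ), K k θ := by
    intro θ hθ
    have hθ' : |θ| ≤ 1 / 2 := abs_le.2 ⟨hθ.1.le, hθ.2⟩
    set k : ℤ := round (τ - θ) with hk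
    have hv : |τ - θ - k| ≤ 1 / 2 := abs_sub_round _
    have hfv : f (τ - θ) = f (τ - θ - k) := by
      simpa using (hf.sub_int_mul_eq k (x := τ - θ)).symm
    rcases le_or_gt (|τ| / 2) |τ - θ - k| with h | h
    · refine le_add_right ?_
      rw [hfv]
      gcongr
      exact hfar _ hv h
    · refine le_add_left ?_
      have hτ' := abs_le.1 hτ
      have hvt := abs_lt.1 h
      have hkr : (-2 : ℝ) < k ∧ (k : ℝ) < 2 := by
        constructor <;> linarith [hθ.1, hθ.2]
      have hk1 : -2 < k := by exact_mod_cast hkr.1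
      have hk2 : k < 2 := by exact_mod_cast hkr.2
      have hkmem : k ∈ ({-1, 0, 1} : Finset ℤ) := by
        simp only [Finset.mem_insert, Finset.mem_singleton]
        omega
      have hθt : |τ| / 2 ≤ |θ| := by
        have hcases : k = -1 ∨ k = 0 ∨ k = 1 := by omega
        rcases hcases with hk' | hk' | hk' <;> rw [hk'] at hvt <;> push_cast at hvt
        · exact le_abs.2 (Or.inl (by linarith))
        · have := abs_sub_abs_le_abs_sub τ θ
          have h2 : |τ - θ| < |τ| / 2 := by rw [abs_lt]; constructor <;> linarith
          linarith
        · exact le_abs.2 (Or.inr (by linarith))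
      have hsq : τ ^ 2 ≤ 4 * θ ^ 2 := by
        rw [← sq_abs τ, ← sq_abs θ]
        nlinarith
      have hτsq : 0 < τ ^ 2 := by positivity
      have hker : poissonKer δ θ ≤ 16 * δ / τ ^ 2 := by
        refine (poissonKer_le hδ hθ').trans ?_
        rw [div_le_div_iff₀ (by positivity) hτsq]
        nlinarith [mul_le_mul_of_nonneg_left hsq h0.le, pow_pos h0 3]
      calc f (τ - θ) * ENNReal.ofReal (poissonKer δ θ)
          ≤ ENNReal.ofReal (2 * τ ^ 2 * B * ((τ - θ - k) ^ 2 + s ^ 2)⁻¹) *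
              ENNReal.ofReal (16 * δ / τ ^ 2) := by
            rw [hfv]
            exact mul_le_mul' (hnear _ h) (ENNReal.ofReal_le_ofReal hker)
        _ = ENNReal.ofReal (32 * B * δ) * K k θ := by
            simp only [hK]
            rw [← ENNReal.ofReal_mul (by positivity), ← ENNReal.ofReal_mul (by positivity),
              sub_right_comm]
            congr 1
            field_simp
            ring
        _ ≤ _ := by
            gcongr
            exact Finset.single_le_sum (f := fun k => K k θ) (fun _ _ => zero_le) hkmem
  calc convPer f (poissonKer δ) τ
      ≤ ∫⁻ θ in Set.Ioc (-(1/2) : ℝ) (1/2),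
          (ENNReal.ofReal (4 * B) * ENNReal.ofReal (poissonKer δ θ) +
            ENNReal.ofReal (32 * B * δ) * ∑ k ∈ ({-1, 0, 1} : Finset ℤ), K k θ) :=
        setLIntegral_mono' measurableSet_Ioc hpt
    _ = ENNReal.ofReal (4 * B) *
            (∫⁻ θ in Set.Ioc (-(1/2) : ℝ) (1/2), ENNReal.ofReal (poissonKer δ θ)) +
          ENNReal.ofReal (32 * B * δ) * ∑ k ∈ ({-1, 0, 1} : Finset ℤ),
            ∫⁻ θ in Set.Ioc (-(1/2) : ℝ) (1/2), K k θ := by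
        rw [lintegral_add_left (hmeas.const_mul _), lintegral_const_mul _ hmeas,
          lintegral_const_mul _ (Finset.measurable_fun_sum _ fun k _ => hKmeas k),
          lintegral_finsetSum _ fun k _ => hKmeas k]
    _ ≤ ENNReal.ofReal (4 * B) * ENNReal.ofReal (4 * Real.pi) +
          ENNReal.ofReal (32 * B * δ) * ∑ k ∈ ({-1, 0, 1} : Finset ℤ),
            ENNReal.ofReal (Real.pi / s) := by
        gcongr with k
        · exact setLIntegral_poissonKer_le hδ
        · exact (setLIntegral_le_lintegral _ _).trans (lintegral_inv_sq_add_sq hs _).le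
    _ = ENNReal.ofReal (4 * B * (4 * Real.pi) + 32 * B * δ * (3 * (Real.pi / s))) := by
        have hcard : ({-1, 0, 1} : Finset ℤ).card = 3 := by decide
        rw [Finset.sum_const, hcard, ← ENNReal.ofReal_nsmul,
          ← ENNReal.ofReal_mul (by positivity), ← ENNReal.ofReal_mul (by positivity),
          ← ENNReal.ofReal_add (by positivity) (by positivity)]
        simp
    _ ≤ _ := by
        refine ENNReal.ofReal_le_ofReal ?_
        have hd : δ / s ≤ c := (div_le_iff₀ hs).2 hδs
        have hpi := Real.pi_pos
        calc 4 * B * (4 * Real.pi) + 32 * B * δ * (3 * (Real.pi / s))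
            = 16 * Real.pi * B + 96 * Real.pi * B * (δ / s) := by ring
          _ ≤ 16 * Real.pi * B + 96 * Real.pi * B * c := by gcongr
          _ = _ := by ring

/-- Estimate of the Poisson integral of the cut-off `φ̃_A = min(φ̃, A)`, case (i):
`φ : (0,1/2] → [0,∞)` unbounded continuous decreasing with `θ ↦ θ²φ(θ)` nondecreasing,
`φ̃` its even 1-periodic extension (with value `∞` at the point `0` of the circle).
For every `c₀ > 0` there is `C > 0` such that, for `A ≥ φ(1/2)` and `0 < δ < 1` with
`δ ≤ c₀·φ⁻¹(A)`, `(φ̃_A * p_δ)(τ) ≤ C(φ̃(τ)+1)` for every `τ ∈ ℝ`. -/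
theorem statement10
    (φ ψ : ℝ → ℝ) (φt : ℝ → ℝ≥0∞)
    -- φ : (0,1/2] → [0,∞) is unbounded, continuous, decreasing
    (hφcont : ContinuousOn φ (Set.Ioc 0 (1/2)))
    (hφanti : StrictAntiOn φ (Set.Ioc 0 (1/2)))
    (hφnonneg : ∀ θ ∈ Set.Ioc (0:ℝ) (1/2), 0 ≤ φ θ)
    (hφunbdd : ¬ BddAbove (φ '' Set.Ioc 0 (1/2)))
    -- θ ↦ θ²·φ(θ) is nondecreasing
    (hφmono : MonotoneOn (fun θ : ℝ => θ ^ 2 * φ θ) (Set.Ioc 0 (1/2)))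
    -- ψ = φ⁻¹ is the inverse of φ
    (hψφ : ∀ θ ∈ Set.Ioc (0:ℝ) (1/2), ψ (φ θ) = θ)
    (hφψ : ∀ a : ℝ, φ (1/2) ≤ a → ψ a ∈ Set.Ioc (0:ℝ) (1/2) ∧ φ (ψ a) = a)
    -- φt = φ̃ is the even 1-periodic extension of φ
    (hext : ∀ θ ∈ Set.Ioc (0:ℝ) (1/2), φt θ = ENNReal.ofReal (φ θ))
    (heven : ∀ θ : ℝ, φt (-θ) = φt θ)
    (hper : ∀ θ : ℝ, φt (θ + 1) = φt θ)
    (hzero : φt 0 = ⊤)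
    (c₀ : ℝ) (hc₀ : 0 < c₀) :
    ∃ C : ℝ, 0 < C ∧ ∀ A δ τ : ℝ, φ (1/2) ≤ A → δ ∈ Set.Ioo (0:ℝ) 1 → δ ≤ c₀ * ψ A →
      convPer (fun θ => min (φt θ) (ENNReal.ofReal A)) (poissonKer δ) τ
        ≤ ENNReal.ofReal C * (φt τ + 1) := by
  refine ⟨16 * Real.pi + 96 * Real.pi * c₀, by positivity, fun A δ τ hA hδ hδA => ?_⟩
  have hφt : Function.Periodic φt 1 := hper
  have hf : Function.Periodic (fun θ => min (φt θ) (ENNReal.ofReal A)) 1 := fun θ => by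
    simp only [hper]
  rw [← convPer_sub_int hf _ τ (round τ),
    show φt τ = φt (τ - round τ) by simpa using (hφt.sub_int_mul_eq (round τ) (x := τ)).symm]
  have hτ : |τ - round τ| ≤ 1 / 2 := abs_sub_round τ
  generalize τ - round τ = t at hτ
  rw [mul_add]
  refine le_add_right ?_
  have habs : ∀ v, φt v = φt |v| := fun v => by
    rcases abs_choice v with h | h <;> rw [h]
    exact (heven v).symm
  have hval : ∀ v, v ≠ 0 → |v| ≤ 1 / 2 → φt v = ENNReal.ofReal (φ |v|) := fun v hv0 hv => by
    rw [habs, hext _ ⟨abs_pos.2 hv0, hv⟩]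
  have hpi := Real.pi_pos
  rcases eq_or_ne t 0 with rfl | ht0
  · rw [hzero, ENNReal.mul_top (by simp only [ne_eq, ENNReal.ofReal_eq_zero, not_le]; positivity)]
    exact le_top
  obtain ⟨hs, hφs⟩ := hφψ A hA
  have ht : |t| ∈ Set.Ioc (0 : ℝ) (1 / 2) := ⟨abs_pos.2 ht0, hτ⟩
  have hB : 0 ≤ φ |t| := hφnonneg _ ht
  rw [hval t ht0 hτ]
  rcases le_or_gt |t| (ψ A) with hle | hlt
  · have hAφ : A ≤ φ |t| := by
      rw [← hφs]
      exact hφanti.antitoneOn ht hs hle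
    refine (convPer_le_of_le_const (fun θ => min_le_right _ _) hδ t).trans ?_
    rw [mul_comm]
    gcongr
    nlinarith [mul_pos hpi hc₀]
  · have hA0 : 0 ≤ A := hφs ▸ hφnonneg _ hs
    have hAM : ψ A ^ 2 * A ≤ t ^ 2 * φ |t| := by
      have h := hφmono hs ht hlt.le
      simpa only [hφs, sq_abs] using h
    rw [← ENNReal.ofReal_mul (by positivity)]
    refine convPer_poissonKer_le hf hδ hs.1 hτ ht0 hB hδA ?_ ?_
    · intro v hv htv
      have hv0 : v ≠ 0 := abs_pos.1 (by linarith [ht.1])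
      have hhalf : |t| / 2 ∈ Set.Ioc (0 : ℝ) (1 / 2) := ⟨by linarith [ht.1], by linarith [ht.1]⟩
      have h1 : φ |v| ≤ φ (|t| / 2) := hφanti.antitoneOn hhalf ⟨abs_pos.2 hv0, hv⟩ htv
      have h2 : (|t| / 2) ^ 2 * φ (|t| / 2) ≤ |t| ^ 2 * φ |t| :=
        hφmono hhalf ht (by linarith [ht.1])
      have h3 : φ (|t| / 2) ≤ 4 * φ |t| := by
        have : 0 < |t| ^ 2 := pow_pos ht.1 2
        refine le_of_mul_le_mul_left ?_ this
        linarith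
      refine (min_le_left _ _).trans ?_
      rw [hval v hv0 hv]
      exact ENNReal.ofReal_le_ofReal (h1.trans h3)
    · intro v hv
      have hden : 0 < v ^ 2 + ψ A ^ 2 := by have := hs.1; positivity
      rcases eq_or_ne v 0 with rfl | hv0
      · refine (min_le_right _ _).trans (ENNReal.ofReal_le_ofReal ?_)
        rw [← div_eq_mul_inv, le_div_iff₀ hden]
        nlinarith [mul_nonneg (sq_nonneg t) hB]
      · have hv' : |v| ∈ Set.Ioc (0 : ℝ) (1 / 2) :=
          ⟨abs_pos.2 hv0, by linarith [ht.1]⟩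
        have hvM : v ^ 2 * φ |v| ≤ t ^ 2 * φ |t| := by
          have h := hφmono hv' ht (by linarith [ht.1])
          simpa only [sq_abs] using h
        rw [hval v hv0 hv'.2, ← ENNReal.ofReal_min]
        refine ENNReal.ofReal_le_ofReal ?_
        rw [← div_eq_mul_inv, le_div_iff₀ hden]
        have h1 := mul_le_mul_of_nonneg_right (min_le_left (φ |v|) A) (sq_nonneg v)
        have h2 := mul_le_mul_of_nonneg_right (min_le_right (φ |v|) A) (sq_nonneg (ψ A))
        linarith
end
end

section
/- Let φ : (0, 1/2] → [0, +∞) be an unbounded continuous decreasing function such that φ(θ/2) ≤ C₁·φ(θ) and φ(θ) ≥ c₁/θ for some C₁, c₁ > 0; let φ̃ be the even 1-periodic extension of φ to ℝ and φ̃_A = min(φ̃, A). For every c₀ > 0 there exists C > 0 such that: for every A ≥ φ(1/2) and every δ ∈ (0, 1) with δ ≤ c₀/A, one has (φ̃_A * p_δ)(τ) ≤ C·(φ̃(τ) + 1) for every τ ∈ ℝ. -/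
open MeasureTheory Set Filter
open scoped ENNReal

noncomputable section

lemma poissonKer_denom_lower {δ θ : ℝ} (hδ : δ ∈ Set.Ioo (0:ℝ) 1) (hθ : |θ| ≤ 1 / 2) :
    δ ^ 2 + 16 * (1 - δ) * θ ^ 2
      ≤ 1 - 2 * (1 - δ) * Real.cos (2 * Real.pi * θ) + (1 - δ) ^ 2 := by
  have hπ := Real.pi_pos
  have hcos : Real.cos (2 * Real.pi * θ) ≤ 1 - 8 * θ ^ 2 := by
    have habs : |2 * Real.pi * θ| ≤ Real.pi := by
      rw [abs_mul, abs_of_pos (by positivity)]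
      nlinarith
    have h := Real.cos_le_one_sub_mul_cos_sq habs
    have hsq : 2 / Real.pi ^ 2 * (2 * Real.pi * θ) ^ 2 = 8 * θ ^ 2 := by field_simp; ring
    linarith
  nlinarith [hδ.2, mul_le_mul_of_nonneg_left hcos (sub_nonneg.2 hδ.2.le)]

lemma poissonKer_le_two_div {δ θ : ℝ} (hδ : δ ∈ Set.Ioo (0:ℝ) 1) (hθ : |θ| ≤ 1 / 2) :
    poissonKer δ θ ≤ 2 / δ := by
  have hden := poissonKer_denom_lower hδ hθ
  obtain ⟨h0, h1⟩ := hδ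
  have hsq : 0 ≤ 16 * (1 - δ) * θ ^ 2 := by
    have := sub_pos.2 h1
    positivity
  have hδ2 : 0 < δ ^ 2 := by positivity
  unfold poissonKer
  rw [div_le_div_iff₀ (by linarith) h0]
  nlinarith

lemma poissonKer_le_div_sq {δ θ : ℝ} (hδ : δ ∈ Set.Ioo (0:ℝ) 1) (hθ : |θ| ≤ 1 / 2)
    (hθ0 : θ ≠ 0) : poissonKer δ θ ≤ δ * θ ^ (-2 : ℝ) := by
  have hden := poissonKer_denom_lower hδ hθ
  obtain ⟨h0, h1⟩ := hδ
  have hθ2 : 0 < θ ^ 2 := by positivity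
  have hθ4 : θ ^ 2 ≤ 1 / 4 := by
    rw [← sq_abs]
    nlinarith [abs_nonneg θ]
  have hden' : 2 * θ ^ 2 ≤ δ ^ 2 + 16 * (1 - δ) * θ ^ 2 := by
    nlinarith [mul_nonneg (sq_nonneg δ) (sub_nonneg.2 hθ4), mul_pos hθ2 (sub_pos.2 h1),
      mul_nonneg hθ2.le (sq_nonneg (1 - δ))]
  have hrpow : θ ^ (-2 : ℝ) = 1 / θ ^ 2 := by
    rw [show (-2 : ℝ) = ((-2 : ℤ) : ℝ) by norm_num, Real.rpow_intCast]
    simp [zpow_neg]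
  unfold poissonKer
  rw [hrpow, mul_one_div, div_le_div_iff₀ (by linarith) hθ2]
  nlinarith [mul_le_mul_of_nonneg_left (hden'.trans hden) h0.le, mul_pos h0 hθ2,
    mul_pos (mul_pos h0 h0) hθ2]

lemma poissonKer_neg (δ θ : ℝ) : poissonKer δ (-θ) = poissonKer δ θ := by
  simp [poissonKer]

lemma lintegral_poissonKer_Ioc_le {δ s : ℝ} (hδ : δ ∈ Set.Ioo (0:ℝ) 1) (hs : 0 < s) :
    ∫⁻ θ in Ioc s (1 / 2), ENNReal.ofReal (poissonKer δ θ) ≤ ENNReal.ofReal (δ / s) := by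
  calc ∫⁻ θ in Ioc s (1 / 2), ENNReal.ofReal (poissonKer δ θ)
      ≤ ∫⁻ θ in Ioc s (1 / 2), ENNReal.ofReal (δ * θ ^ (-2 : ℝ)) := by
        refine setLIntegral_mono' measurableSet_Ioc fun θ hθ => ENNReal.ofReal_le_ofReal ?_
        have h0 : 0 < θ := hs.trans hθ.1
        exact poissonKer_le_div_sq hδ ((abs_of_pos h0).trans_le hθ.2) h0.ne'
    _ ≤ ∫⁻ θ in Ioi s, ENNReal.ofReal (δ * θ ^ (-2 : ℝ)) :=
        lintegral_mono_set Ioc_subset_Ioi_self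
    _ = ENNReal.ofReal (∫ θ in Ioi s, δ * θ ^ (-2 : ℝ)) := by
        refine (ofReal_integral_eq_lintegral_ofReal
          ((integrableOn_Ioi_rpow_of_lt (by norm_num) hs).const_mul δ) ?_).symm
        filter_upwards [ae_restrict_mem measurableSet_Ioi] with θ hθ
        exact mul_nonneg hδ.1.le (Real.rpow_nonneg (hs.trans hθ).le _)
    _ = ENNReal.ofReal (δ / s) := by
        rw [integral_const_mul, integral_Ioi_rpow_of_lt (by norm_num) hs]
        norm_num [Real.rpow_neg_one, div_eq_mul_inv]

lemma lintegral_poissonKer_Ico_neg_le {δ s : ℝ} (hδ : δ ∈ Set.Ioo (0:ℝ) 1) (hs : 0 < s) :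
    ∫⁻ θ in Ico (-(1 / 2)) (-s), ENNReal.ofReal (poissonKer δ θ) ≤ ENNReal.ofReal (δ / s) := by
  rw [← (Measure.measurePreserving_neg (volume : Measure ℝ)).setLIntegral_comp_preimage_emb
    (MeasurableEquiv.neg ℝ).measurableEmbedding]
  simpa [poissonKer_neg] using lintegral_poissonKer_Ioc_le hδ hs

/-- The part of the Poisson kernel at distance more than `s` from the origin. -/
lemma lintegral_poissonKer_tail_le {δ s : ℝ} (hδ : δ ∈ Set.Ioo (0:ℝ) 1) (hs : 0 < s) :
    ∫⁻ θ in Ico (-(1 / 2)) (-s) ∪ Ioc s (1 / 2), ENNReal.ofReal (poissonKer δ θ)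
      ≤ ENNReal.ofReal (2 * δ / s) := by
  have hδs : 0 ≤ δ / s := (div_pos hδ.1 hs).le
  refine (lintegral_union_le _ _ _).trans ?_
  rw [show 2 * δ / s = δ / s + δ / s by ring, ENNReal.ofReal_add hδs hδs]
  exact add_le_add (lintegral_poissonKer_Ico_neg_le hδ hs) (lintegral_poissonKer_Ioc_le hδ hs)

lemma Ioc_half_subset_core_union_tail (s : ℝ) :
    Ioc (-(1 / 2) : ℝ) (1 / 2) ⊆
      (Icc (-s) s ∩ Icc (-(1 / 2)) (1 / 2)) ∪ (Ico (-(1 / 2)) (-s) ∪ Ioc s (1 / 2)) := by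
  intro θ hθ
  simp only [mem_union, mem_inter_iff, mem_Icc, mem_Ico, mem_Ioc] at *
  grind

lemma lintegral_poissonKer_le {δ : ℝ} (hδ : δ ∈ Set.Ioo (0:ℝ) 1) :
    ∫⁻ θ in Icc (-(1 / 2) : ℝ) (1 / 2), ENNReal.ofReal (poissonKer δ θ) ≤ ENNReal.ofReal 6 := by
  have h0 := hδ.1
  rw [restrict_Ioc_eq_restrict_Icc.symm]
  refine ((lintegral_mono_set (Ioc_half_subset_core_union_tail δ)).trans
    (lintegral_union_le _ _ _)).trans ?_
  rw [show (6 : ℝ) = 2 / δ * (δ - -δ) + 2 * δ / δ by field_simp; norm_num,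
    ENNReal.ofReal_add (by simp; positivity) (by positivity),
    ENNReal.ofReal_mul (by positivity)]
  refine add_le_add ?_ (lintegral_poissonKer_tail_le hδ h0)
  calc ∫⁻ θ in Icc (-δ) δ ∩ Icc (-(1 / 2)) (1 / 2), ENNReal.ofReal (poissonKer δ θ)
      ≤ ∫⁻ θ in Icc (-δ) δ ∩ Icc (-(1 / 2)) (1 / 2), ENNReal.ofReal (2 / δ) :=
        setLIntegral_mono' (measurableSet_Icc.inter measurableSet_Icc) fun θ hθ =>
          ENNReal.ofReal_le_ofReal (poissonKer_le_two_div hδ (abs_le.2 hθ.2))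
    _ ≤ ∫⁻ θ in Icc (-δ) δ, ENNReal.ofReal (2 / δ) := lintegral_mono_set inter_subset_left
    _ = ENNReal.ofReal (2 / δ) * ENNReal.ofReal (δ - -δ) := by
        rw [setLIntegral_const, Real.volume_Icc]

lemma apply_abs_sub_round {α : Type*} {f : ℝ → α} (heven : ∀ θ, f (-θ) = f θ)
    (hper : ∀ θ, f (θ + 1) = f θ) (x : ℝ) : f |x - round x| = f x := by
  have h : f (x - round x) = f x := by
    simpa using Function.Periodic.sub_zsmul_eq (f := f) hper (round x) (x := x)
  rcases abs_choice (x - round x) with h' | h' <;> rw [h']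
  · exact h
  · rw [heven, h]

lemma abs_sub_round_le_add (x y : ℝ) : |x - round x| ≤ |x - y - round (x - y)| + |y| := by
  refine (round_le x (round (x - y))).trans ?_
  rw [show x - round (x - y) = (x - y - round (x - y)) + y by ring]
  exact abs_add_le _ _

/-- Estimate of the Poisson integral of the cut-off `φ̃_A = min(φ̃, A)`, case (ii):
`φ : (0,1/2] → [0,∞)` unbounded continuous decreasing with `φ(θ/2) ≤ C₁·φ(θ)` and
`φ(θ) ≥ c₁/θ`. For every `c₀ > 0` there is `C > 0` such that, for `A ≥ φ(1/2)` and
`0 < δ < 1` with `δ ≤ c₀/A`, `(φ̃_A * p_δ)(τ) ≤ C(φ̃(τ)+1)` for every `τ ∈ ℝ`. -/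
theorem statement11
    (φ : ℝ → ℝ) (φt : ℝ → ℝ≥0∞)
    -- φ : (0,1/2] → [0,∞) is unbounded, continuous, decreasing
    (hφcont : ContinuousOn φ (Set.Ioc 0 (1/2)))
    (hφanti : StrictAntiOn φ (Set.Ioc 0 (1/2)))
    (hφnonneg : ∀ θ ∈ Set.Ioc (0:ℝ) (1/2), 0 ≤ φ θ)
    (hφunbdd : ¬ BddAbove (φ '' Set.Ioc 0 (1/2)))
    -- regularity: φ(θ/2) ≤ C₁·φ(θ) and φ(θ) ≥ c₁/θ
    (C₁ : ℝ) (hC₁ : 0 < C₁)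
    (hreg2a : ∀ θ ∈ Set.Ioc (0:ℝ) (1/2), φ (θ/2) ≤ C₁ * φ θ)
    (c₁ : ℝ) (hc₁ : 0 < c₁)
    (hreg2b : ∀ θ ∈ Set.Ioc (0:ℝ) (1/2), c₁ / θ ≤ φ θ)
    -- φt = φ̃ is the even 1-periodic extension of φ
    (hext : ∀ θ ∈ Set.Ioc (0:ℝ) (1/2), φt θ = ENNReal.ofReal (φ θ))
    (heven : ∀ θ : ℝ, φt (-θ) = φt θ)
    (hper : ∀ θ : ℝ, φt (θ + 1) = φt θ)
    (hzero : φt 0 = ⊤)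
    (c₀ : ℝ) (hc₀ : 0 < c₀) :
    ∃ C : ℝ, 0 < C ∧ ∀ A δ τ : ℝ, φ (1/2) ≤ A → δ ∈ Set.Ioo (0:ℝ) 1 → δ ≤ c₀ / A →
      convPer (fun θ => min (φt θ) (ENNReal.ofReal A)) (poissonKer δ) τ
        ≤ ENNReal.ofReal C * (φt τ + 1) := by
  have hhalf : (1 / 2 : ℝ) ∈ Ioc (0:ℝ) (1 / 2) := by norm_num
  refine ⟨6 * C₁ + 4 * c₀ / c₁, by positivity, fun A δ τ hA hδ hδA => ?_⟩
  have hApos : 0 < A := (by positivity : 0 < c₁ / (1 / 2)).trans_le ((hreg2b _ hhalf).trans hA)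
  have hAδ : A * δ ≤ c₀ := by rwa [mul_comm, ← le_div_iff₀ hApos]
  rw [← apply_abs_sub_round heven hper τ]
  have hd_le : |τ - round τ| ≤ 1 / 2 := abs_sub_round τ
  have hdist := abs_sub_round_le_add τ
  obtain hd0 | hd0 := (abs_nonneg (τ - round τ)).eq_or_lt
  · rw [← hd0, hzero, top_add, ENNReal.mul_top (by simp; positivity)]
    exact le_top
  generalize |τ - round τ| = d at *
  have hd : d ∈ Ioc (0:ℝ) (1 / 2) := ⟨hd0, hd_le⟩
  have hφd := hφnonneg d hd
  have hcore : ∀ θ, |θ| ≤ d / 2 → φt (τ - θ) ≤ ENNReal.ofReal (C₁ * φ d) := by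
    intro θ hθ
    have hx : d / 2 ≤ |τ - θ - round (τ - θ)| := by linarith [hdist θ]
    have hx' : |τ - θ - round (τ - θ)| ∈ Ioc (0:ℝ) (1 / 2) :=
      ⟨by linarith, abs_sub_round _⟩
    rw [← apply_abs_sub_round heven hper, hext _ hx']
    exact ENNReal.ofReal_le_ofReal <|
      (hφanti.antitoneOn ⟨by linarith, by linarith⟩ hx' hx).trans (hreg2a d hd)
  have hnear : ∫⁻ θ in Icc (-(d / 2)) (d / 2) ∩ Icc (-(1 / 2)) (1 / 2),
      min (φt (τ - θ)) (ENNReal.ofReal A) * ENNReal.ofReal (poissonKer δ θ)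
        ≤ ENNReal.ofReal (C₁ * φ d) * ENNReal.ofReal 6 := by
    refine (setLIntegral_mono' (measurableSet_Icc.inter measurableSet_Icc) fun θ hθ =>
      mul_le_mul_left ((min_le_left _ _).trans (hcore θ (abs_le.2 hθ.1))) _).trans ?_
    rw [lintegral_const_mul' _ _ ENNReal.ofReal_ne_top]
    gcongr
    exact (lintegral_mono_set inter_subset_right).trans (lintegral_poissonKer_le hδ)
  have hfar : ∫⁻ θ in Ico (-(1 / 2)) (-(d / 2)) ∪ Ioc (d / 2) (1 / 2),
      min (φt (τ - θ)) (ENNReal.ofReal A) * ENNReal.ofReal (poissonKer δ θ)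
        ≤ ENNReal.ofReal A * ENNReal.ofReal (2 * δ / (d / 2)) := by
    refine (lintegral_mono fun θ => mul_le_mul_left (min_le_right _ _) _).trans ?_
    rw [lintegral_const_mul' _ _ ENNReal.ofReal_ne_top]
    gcongr
    exact lintegral_poissonKer_tail_le hδ (half_pos hd0)
  have hreal : A * (2 * δ / (d / 2)) ≤ 4 * c₀ / c₁ * φ d :=
    calc A * (2 * δ / (d / 2)) = 4 * (A * δ) / d := by field_simp; ring
      _ ≤ 4 * c₀ / d := by gcongr
      _ = 4 * c₀ / c₁ * (c₁ / d) := by field_simp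
      _ ≤ 4 * c₀ / c₁ * φ d := by gcongr; exact hreg2b d hd
  unfold convPer
  refine (((lintegral_mono_set (Ioc_half_subset_core_union_tail (d / 2))).trans
    (lintegral_union_le _ _ _)).trans (add_le_add hnear hfar)).trans ?_
  have hδ0 := hδ.1
  rw [← ENNReal.ofReal_mul (by positivity), ← ENNReal.ofReal_mul hApos.le,
    ← ENNReal.ofReal_add (by positivity) (by positivity), hext d hd]
  calc ENNReal.ofReal (C₁ * φ d * 6 + A * (2 * δ / (d / 2)))
      ≤ ENNReal.ofReal ((6 * C₁ + 4 * c₀ / c₁) * φ d) :=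
        ENNReal.ofReal_le_ofReal (by linarith)
    _ = ENNReal.ofReal (6 * C₁ + 4 * c₀ / c₁) * ENNReal.ofReal (φ d) :=
        ENNReal.ofReal_mul (by positivity)
    _ ≤ _ := by gcongr; exact le_self_add
end
end
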